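/- Fix an integer d ≥ 1, s > 0 and n ≥ 0. A polynomial q in d variables with complex coefficients is of the form q = e^{−sΔ/2}p for some polynomial p homogeneous of degree n (or p = 0) if and only if q has degree at most n and q is orthogonal in L²(ℝ^d, P_s) to every polynomial of degree at most n − 1; that is, the n-th Hermite subspace F_{n,s} = e^{−sΔ/2}(homogeneous polynomials of degree n) consists exactly of the polynomials of degree n that are orthogonal to all polynomials of lower degree. -/

import Mathlib

open MeasureTheory

noncomputable section

/-- The Gaussian density `P_s(x) = (2πs)^{-d/2} exp(-|x|²/(2s))` on `ℝ^d`. -/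
def gaussDensity (d : ℕ) (s : ℝ) (x : Fin d → ℝ) : ℝ :=
  (2 * Real.pi * s) ^ (-(d : ℝ) / 2) * Real.exp (-(∑ i, x i ^ 2) / (2 * s))

/-- The Gaussian measure `P_s` on `ℝ^d`. -/
def gaussMeasure (d : ℕ) (s : ℝ) : Measure (Fin d → ℝ) :=
  volume.withDensity fun x => ENNReal.ofReal (gaussDensity d s x)

/-- The analytic continuation `P_t(z) = (2πt)^{-d/2} exp(-(z₁² + ⋯ + z_d²)/(2t))` of the
Gaussian density to `ℂ^d`. -/
def heatKernelC (d : ℕ) (t : ℝ) (z : Fin d → ℂ) : ℂ :=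
  (((2 * Real.pi * t) ^ (-(d : ℝ) / 2) : ℝ) : ℂ) * Complex.exp (-(∑ i, z i ^ 2) / (2 * t))

/-- The inclusion of `ℝ^d` into `ℂ^d`. -/
def coeRC (d : ℕ) (x : Fin d → ℝ) : Fin d → ℂ := fun i => (x i : ℂ)

/-- The Laplacian `Δ = Σ_j ∂²/∂x_j²` acting on polynomials. -/
def mvLaplacian (d : ℕ) (p : MvPolynomial (Fin d) ℂ) : MvPolynomial (Fin d) ℂ :=
  ∑ j : Fin d, MvPolynomial.pderiv j (MvPolynomial.pderiv j p)

/-- The heat operator `e^{cΔ/2}` on polynomials, given by the finite sum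
`Σ_k (c/2)^k Δ^k p / k!` (which terminates since `Δ^k p = 0` once `2k` exceeds the degree). -/
def heatOp (d : ℕ) (c : ℝ) (p : MvPolynomial (Fin d) ℂ) : MvPolynomial (Fin d) ℂ :=
  ∑ k ∈ Finset.range (p.totalDegree + 1),
    (((c : ℂ) / 2) ^ k / (Nat.factorial k : ℂ)) • (mvLaplacian d)^[k] p

/-- Evaluation of a complex polynomial at a real point of `ℝ^d`. -/
def evalR (d : ℕ) (p : MvPolynomial (Fin d) ℂ) (x : Fin d → ℝ) : ℂ :=
  MvPolynomial.eval (fun i => (x i : ℂ)) p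

/-! ### Algebraic properties of the Laplacian and the heat operator -/

/-- All coefficients of `p` in degrees at least `n` vanish, i.e. `p` has degree less than `n`. -/
def DegLT {d : ℕ} (n : ℕ) (p : MvPolynomial (Fin d) ℂ) : Prop :=
  ∀ m : Fin d →₀ ℕ, n ≤ m.degree → p.coeff m = 0

namespace DegLT

variable {d n : ℕ} {p : MvPolynomial (Fin d) ℂ}

theorem of_totalDegree_lt (h : p.totalDegree < n) : DegLT n p := fun _ hm =>
  MvPolynomial.coeff_eq_zero_of_totalDegree_lt (h.trans_le hm)

theorem totalDegree_le (h : DegLT (n + 1) p) : p.totalDegree ≤ n := by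
  refine Finset.sup_le fun m hm => ?_
  by_contra! hlt
  exact MvPolynomial.mem_support_iff.1 hm (h m hlt)

theorem eq_zero (h : DegLT 0 p) : p = 0 := by
  ext m
  simpa using h m (Nat.zero_le _)

theorem mono {k : ℕ} (h : DegLT n p) (hk : n ≤ k) : DegLT k p := fun m hm => h m (hk.trans hm)

theorem smul (h : DegLT n p) (a : ℂ) : DegLT n (a • p) := fun m hm => by
  simp [h m hm]

theorem sum {ι : Type*} {t : Finset ι} {f : ι → MvPolynomial (Fin d) ℂ}
    (h : ∀ i ∈ t, DegLT n (f i)) : DegLT n (∑ i ∈ t, f i) := fun m hm => by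
  rw [MvPolynomial.coeff_sum]
  exact Finset.sum_eq_zero fun i hi => h i hi m hm

theorem of_isHomogeneous (h : p.IsHomogeneous n) : DegLT (n + 1) p := fun _ hm =>
  h.coeff_eq_zero (Nat.lt_of_succ_le hm).ne'

theorem pderiv (h : DegLT n p) (j : Fin d) : DegLT (n - 1) (MvPolynomial.pderiv j p) :=
  fun m hm => by
    rw [MvPolynomial.coeff_pderiv, h, zero_mul]
    rw [map_add, Finsupp.degree_single]
    omega

theorem mvLaplacian (h : DegLT n p) : DegLT (n - 1) (mvLaplacian d p) :=
  sum fun j _ => ((h.pderiv j).pderiv j).mono (Nat.sub_le _ _)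

theorem mvLaplacian_iterate (h : DegLT n p) (k : ℕ) :
    DegLT (n - k) ((_root_.mvLaplacian d)^[k] p) := by
  induction k with
  | zero => exact h
  | succ k ih =>
    rw [Function.iterate_succ_apply', ← Nat.sub_sub]
    exact ih.mvLaplacian

end DegLT

theorem MvPolynomial.pderiv_pderiv_comm {σ R : Type*} [CommSemiring R] (i j : σ)
    (p : MvPolynomial σ R) : pderiv i (pderiv j p) = pderiv j (pderiv i p) := by
  classical
  ext m
  simp only [coeff_pderiv, Finsupp.add_apply, Finsupp.single_apply, add_right_comm m]
  by_cases h : i = j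
  · subst h; rfl
  · simp only [h, Ne.symm h, if_false, Nat.add_zero]
    ring

/-- The Laplacian on polynomials as a linear map. -/
def mvLaplacianLin (d : ℕ) : Module.End ℂ (MvPolynomial (Fin d) ℂ) :=
  ∑ j : Fin d, (MvPolynomial.pderiv j).toLinearMap * (MvPolynomial.pderiv j).toLinearMap

theorem mvLaplacianLin_apply (d : ℕ) (p : MvPolynomial (Fin d) ℂ) :
    mvLaplacianLin d p = mvLaplacian d p := by
  simp [mvLaplacianLin, mvLaplacian]

theorem mvLaplacianLin_pow_apply (d k : ℕ) (p : MvPolynomial (Fin d) ℂ) :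
    (mvLaplacianLin d ^ k) p = (mvLaplacian d)^[k] p := by
  rw [Module.End.pow_apply]
  congr 2
  exact funext (mvLaplacianLin_apply d)

theorem mvLaplacian_X_mul {d : ℕ} (j : Fin d) (p : MvPolynomial (Fin d) ℂ) :
    mvLaplacian d (MvPolynomial.X j * p) =
      MvPolynomial.X j * mvLaplacian d p + (2 : ℂ) • MvPolynomial.pderiv j p := by
  have h (i : Fin d) :
      MvPolynomial.pderiv i (MvPolynomial.pderiv i (MvPolynomial.X j * p)) =
        MvPolynomial.X j * MvPolynomial.pderiv i (MvPolynomial.pderiv i p) +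
          (if i = j then (2 : ℂ) • MvPolynomial.pderiv j p else 0) := by
    by_cases hij : i = j
    · subst hij
      simp [Derivation.leibniz, two_smul]
      ring
    · simp [Derivation.leibniz, MvPolynomial.pderiv_X_of_ne (Ne.symm hij), hij]
  simp_rw [mvLaplacian, h, Finset.sum_add_distrib, Finset.mul_sum]
  simp

theorem mvLaplacian_pderiv {d : ℕ} (j : Fin d) (p : MvPolynomial (Fin d) ℂ) :
    mvLaplacian d (MvPolynomial.pderiv j p) = MvPolynomial.pderiv j (mvLaplacian d p) := by
  simp_rw [mvLaplacian, map_sum, MvPolynomial.pderiv_pderiv_comm _ j]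

theorem mvLaplacian_iterate_succ_X_mul {d : ℕ} (j : Fin d) (p : MvPolynomial (Fin d) ℂ) (k : ℕ) :
    (mvLaplacian d)^[k + 1] (MvPolynomial.X j * p) =
      MvPolynomial.X j * (mvLaplacian d)^[k + 1] p +
        (2 * (k + 1) : ℂ) • MvPolynomial.pderiv j ((mvLaplacian d)^[k] p) := by
  induction k with
  | zero => simp [mvLaplacian_X_mul]
  | succ k ih =>
    rw [Function.iterate_succ_apply', ih, ← mvLaplacianLin_apply, map_add, map_smul,
      mvLaplacianLin_apply, mvLaplacianLin_apply, mvLaplacian_X_mul, mvLaplacian_pderiv,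
      ← Function.iterate_succ_apply' (mvLaplacian d) k,
      ← Function.iterate_succ_apply' (mvLaplacian d) (k + 1), add_assoc, ← add_smul]
    congr 2
    push_cast
    ring

/-- The heat operator `e^{cΔ/2}` truncated after its first `N` terms, as a linear map. -/
def heatTrunc (d : ℕ) (c : ℝ) (N : ℕ) : Module.End ℂ (MvPolynomial (Fin d) ℂ) :=
  ∑ k ∈ Finset.range N, (((c : ℂ) / 2) ^ k / (Nat.factorial k : ℂ)) • mvLaplacianLin d ^ k

theorem heatTrunc_apply (d : ℕ) (c : ℝ) (N : ℕ) (p : MvPolynomial (Fin d) ℂ) :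
    heatTrunc d c N p = ∑ k ∈ Finset.range N,
      (((c : ℂ) / 2) ^ k / (Nat.factorial k : ℂ)) • (mvLaplacian d)^[k] p := by
  simp [heatTrunc, LinearMap.sum_apply, mvLaplacianLin_pow_apply]

theorem heatTrunc_eq_of_le {d n N : ℕ} {p : MvPolynomial (Fin d) ℂ} (h : DegLT n p) (c : ℝ)
    (hN : n ≤ N) : heatTrunc d c N p = heatTrunc d c n p := by
  rw [heatTrunc_apply, heatTrunc_apply]
  refine (Finset.sum_subset (Finset.range_mono hN) fun k _ hk => ?_).symm
  have hk' : n - k = 0 := Nat.sub_eq_zero_of_le (by simpa using hk)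
  have h0 := h.mvLaplacian_iterate k
  rw [hk'] at h0
  rw [h0.eq_zero, smul_zero]

theorem heatOp_eq_heatTrunc {d n : ℕ} {p : MvPolynomial (Fin d) ℂ} (h : DegLT (n + 1) p) (c : ℝ) :
    heatOp d c p = heatTrunc d c (n + 1) p := by
  rw [heatTrunc_eq_of_le (DegLT.of_totalDegree_lt p.totalDegree.lt_succ_self) c
    (Nat.succ_le_succ h.totalDegree_le), heatTrunc_apply]
  rfl

theorem DegLT.heatTrunc {d n : ℕ} {p : MvPolynomial (Fin d) ℂ} (h : DegLT n p) (c : ℝ) (N : ℕ) :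
    DegLT n (heatTrunc d c N p) := by
  rw [heatTrunc_apply]
  exact DegLT.sum fun k _ => ((h.mvLaplacian_iterate k).mono (Nat.sub_le _ _)).smul _

theorem DegLT.sub_heatTrunc {d n : ℕ} {p : MvPolynomial (Fin d) ℂ} (h : DegLT (n + 1) p) (c : ℝ)
    (N : ℕ) : DegLT n (p - _root_.heatTrunc d c (N + 1) p) := by
  rw [heatTrunc_apply, Finset.sum_range_succ']
  have hsum : DegLT n (∑ k ∈ Finset.range N,
      (((c : ℂ) / 2) ^ (k + 1) / (Nat.factorial (k + 1) : ℂ)) • (_root_.mvLaplacian d)^[k + 1] p) :=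
    DegLT.sum fun k _ => ((h.mvLaplacian_iterate (k + 1)).mono (by omega)).smul _
  intro m hm
  simpa using hsum m hm

/-- The commutation relation `e^{cΔ/2} x_j = (x_j + c ∂_j) e^{cΔ/2}`, for truncations. -/
theorem heatTrunc_succ_X_mul {d : ℕ} (c : ℝ) (N : ℕ) (j : Fin d) (p : MvPolynomial (Fin d) ℂ) :
    heatTrunc d c (N + 1) (MvPolynomial.X j * p) =
      MvPolynomial.X j * heatTrunc d c (N + 1) p +
        (c : ℂ) • MvPolynomial.pderiv j (heatTrunc d c N p) := by
  rw [heatTrunc_apply, heatTrunc_apply, heatTrunc_apply, Finset.sum_range_succ',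
    Finset.sum_range_succ' _ N]
  simp only [mvLaplacian_iterate_succ_X_mul, smul_add, Finset.sum_add_distrib, mul_add,
    Finset.mul_sum, map_sum, Finset.smul_sum, mul_smul_comm, Derivation.map_smul, smul_smul]
  rw [add_right_comm]
  congr 1
  refine Finset.sum_congr rfl fun k _ => ?_
  congr 1
  have hk : (Nat.factorial k : ℂ) ≠ 0 := by exact_mod_cast k.factorial_ne_zero
  have hk1 : (k : ℂ) + 1 ≠ 0 := by exact_mod_cast k.succ_ne_zero
  rw [Nat.factorial_succ]
  push_cast
  field_simp
  ring

/-! ### Gaussian integration of polynomials -/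

theorem integrable_pow_mul_exp {s : ℝ} (hs : 0 < s) (k : ℕ) :
    Integrable fun x : ℝ => x ^ k * Real.exp (-x ^ 2 / (2 * s)) := by
  have h := integrable_rpow_mul_exp_neg_mul_sq (b := 1 / (2 * s)) (by positivity)
    (s := k) (by linarith [k.cast_nonneg (α := ℝ)])
  refine h.congr (ae_of_all _ fun x => ?_)
  simp only [Real.rpow_natCast]
  congr 2
  ring

/-- The unnormalised moment of order `k` of the one-dimensional centred Gaussian of variance `s`. -/
def gaussMoment (s : ℝ) (k : ℕ) : ℝ := ∫ x : ℝ, x ^ k * Real.exp (-x ^ 2 / (2 * s))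

theorem gaussMoment_succ {s : ℝ} (hs : 0 < s) (k : ℕ) :
    gaussMoment s (k + 1) = s * k * gaussMoment s (k - 1) := by
  have hderiv (x : ℝ) : HasDerivAt (fun x : ℝ => x ^ k * Real.exp (-x ^ 2 / (2 * s)))
      (k * (x ^ (k - 1) * Real.exp (-x ^ 2 / (2 * s))) -
        s⁻¹ * (x ^ (k + 1) * Real.exp (-x ^ 2 / (2 * s)))) x := by
    have h := (hasDerivAt_pow k x).mul
      (((hasDerivAt_pow 2 x).neg.div_const (2 * s)).exp)
    refine h.congr_deriv ?_
    have : s ≠ 0 := hs.ne'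
    simp only [Pi.neg_apply]
    push_cast
    field_simp
    ring
  have h1 := (integrable_pow_mul_exp hs (k - 1)).const_mul (k : ℝ)
  have h2 := (integrable_pow_mul_exp hs (k + 1)).const_mul s⁻¹
  have h := integral_eq_zero_of_hasDerivAt_of_integrable hderiv (h1.sub h2)
    (integrable_pow_mul_exp hs k)
  rw [integral_sub h1 h2, integral_const_mul, integral_const_mul] at h
  change k * gaussMoment s (k - 1) - s⁻¹ * gaussMoment s (k + 1) = 0 at h
  have : s ≠ 0 := hs.ne'
  field_simp at h
  linarith

theorem gaussDensity_pos (d : ℕ) {s : ℝ} (hs : 0 < s) (x : Fin d → ℝ) : 0 < gaussDensity d s x := by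
  unfold gaussDensity
  positivity

theorem measurable_gaussDensity (d : ℕ) (s : ℝ) :
    Measurable fun x => ENNReal.ofReal (gaussDensity d s x) := by
  unfold gaussDensity
  fun_prop

theorem integral_gaussMeasure (d : ℕ) {s : ℝ} (hs : 0 < s) (f : (Fin d → ℝ) → ℂ) :
    ∫ x, f x ∂gaussMeasure d s = ∫ x, gaussDensity d s x • f x := by
  rw [gaussMeasure, integral_withDensity_eq_integral_toReal_smul (measurable_gaussDensity d s)
    (ae_of_all _ fun _ => ENNReal.ofReal_lt_top)]
  simp_rw [ENNReal.toReal_ofReal (gaussDensity_pos d hs _).le]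

theorem integrable_gaussMeasure_iff (d : ℕ) {s : ℝ} (hs : 0 < s) (f : (Fin d → ℝ) → ℂ) :
    Integrable f (gaussMeasure d s) ↔ Integrable fun x => gaussDensity d s x • f x := by
  rw [gaussMeasure, integrable_withDensity_iff_integrable_smul' (measurable_gaussDensity d s)
    (ae_of_all _ fun _ => ENNReal.ofReal_lt_top)]
  simp_rw [ENNReal.toReal_ofReal (gaussDensity_pos d hs _).le]

theorem gaussDensity_smul_evalR_monomial (d : ℕ) (s : ℝ) (m : Fin d →₀ ℕ) (a : ℂ)
    (x : Fin d → ℝ) :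
    gaussDensity d s x • evalR d (MvPolynomial.monomial m a) x =
      (((2 * Real.pi * s) ^ (-(d : ℝ) / 2) : ℝ) * a) *
        ∏ i, ((x i ^ m i * Real.exp (-x i ^ 2 / (2 * s)) : ℝ) : ℂ) := by
  have h : Real.exp (-(∑ i, x i ^ 2) / (2 * s)) = ∏ i, Real.exp (-x i ^ 2 / (2 * s)) := by
    rw [← Real.exp_sum, ← Finset.sum_neg_distrib, Finset.sum_div]
  rw [gaussDensity, h, evalR, MvPolynomial.eval_monomial,
    Finsupp.prod_fintype _ _ fun _ => pow_zero _, Complex.real_smul]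
  push_cast
  rw [Finset.prod_mul_distrib]
  ring

theorem integrable_evalR (d : ℕ) {s : ℝ} (hs : 0 < s) (p : MvPolynomial (Fin d) ℂ) :
    Integrable (evalR d p) (gaussMeasure d s) := by
  induction p using MvPolynomial.induction_on' with
  | monomial m a =>
    rw [integrable_gaussMeasure_iff d hs]
    simp_rw [gaussDensity_smul_evalR_monomial]
    refine Integrable.const_mul ?_ _
    exact Integrable.fintype_prod
      (f := fun i (t : ℝ) => ((t ^ m i * Real.exp (-t ^ 2 / (2 * s)) : ℝ) : ℂ))
      fun i => (integrable_pow_mul_exp hs (m i)).ofReal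
  | add p q hp hq =>
    refine (hp.add hq).congr (ae_of_all _ fun x => ?_)
    simp [evalR]

/-- Integration of polynomials against the Gaussian measure, as a linear functional. -/
def gaussFunctional (d : ℕ) {s : ℝ} (hs : 0 < s) : MvPolynomial (Fin d) ℂ →ₗ[ℂ] ℂ where
  toFun p := ∫ x, evalR d p x ∂gaussMeasure d s
  map_add' p q := by
    rw [← integral_add (integrable_evalR d hs p) (integrable_evalR d hs q)]
    simp [evalR]
  map_smul' a p := by
    rw [RingHom.id_apply, ← integral_smul]
    simp [evalR, MvPolynomial.smul_eval]

theorem gaussFunctional_apply (d : ℕ) {s : ℝ} (hs : 0 < s) (p : MvPolynomial (Fin d) ℂ) :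
    gaussFunctional d hs p = ∫ x, evalR d p x ∂gaussMeasure d s := rfl

theorem gaussFunctional_monomial (d : ℕ) {s : ℝ} (hs : 0 < s) (m : Fin d →₀ ℕ) (a : ℂ) :
    gaussFunctional d hs (MvPolynomial.monomial m a) =
      (((2 * Real.pi * s) ^ (-(d : ℝ) / 2) : ℝ) * a) * ∏ i, (gaussMoment s (m i) : ℂ) := by
  rw [gaussFunctional_apply, integral_gaussMeasure d hs]
  simp_rw [gaussDensity_smul_evalR_monomial]
  rw [integral_const_mul, integral_fintype_prod_volume_eq_prod
    (f := fun i (t : ℝ) => ((t ^ m i * Real.exp (-t ^ 2 / (2 * s)) : ℝ) : ℂ))]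
  simp_rw [integral_complex_ofReal]
  rfl

/-- Gaussian integration by parts for polynomials. -/
theorem gaussFunctional_X_mul (d : ℕ) {s : ℝ} (hs : 0 < s) (j : Fin d)
    (p : MvPolynomial (Fin d) ℂ) :
    gaussFunctional d hs (MvPolynomial.X j * p) =
      s * gaussFunctional d hs (MvPolynomial.pderiv j p) := by
  classical
  induction p using MvPolynomial.induction_on' with
  | monomial m a =>
    rw [MvPolynomial.X, MvPolynomial.monomial_mul, one_mul, MvPolynomial.pderiv_monomial,
      gaussFunctional_monomial, gaussFunctional_monomial,
      ← Finset.mul_prod_erase _ _ (Finset.mem_univ j),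
      ← Finset.mul_prod_erase _
        (fun i => (gaussMoment s ((m - Finsupp.single j 1 : Fin d →₀ ℕ) i) : ℂ))
        (Finset.mem_univ j)]
    have hprod : ∏ i ∈ Finset.univ.erase j,
          (gaussMoment s ((Finsupp.single j 1 + m : Fin d →₀ ℕ) i) : ℂ) =
        ∏ i ∈ Finset.univ.erase j,
          (gaussMoment s ((m - Finsupp.single j 1 : Fin d →₀ ℕ) i) : ℂ) := by
      refine Finset.prod_congr rfl fun i hi => ?_
      have hij : j ≠ i := (Finset.ne_of_mem_erase hi).symm
      simp [Finsupp.single_eq_of_ne' hij]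
    rw [hprod]
    have hj : gaussMoment s ((Finsupp.single j 1 + m : Fin d →₀ ℕ) j) =
        s * m j * gaussMoment s ((m - Finsupp.single j 1 : Fin d →₀ ℕ) j) := by
      simpa [add_comm] using gaussMoment_succ hs (m j)
    rw [hj]
    push_cast
    ring
  | add p q hp hq => rw [mul_add, map_add, map_add, map_add, hp, hq, mul_add]

theorem gaussFunctional_mul_heatTrunc (d : ℕ) {s : ℝ} (hs : 0 < s) {n : ℕ}
    {p q : MvPolynomial (Fin d) ℂ} (hp : p.IsHomogeneous n) (hq : DegLT n q) :
    gaussFunctional d hs (q * heatTrunc d (-s) (n + 1) p) = 0 := by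
  induction n generalizing p q with
  | zero => rw [hq.eq_zero, zero_mul, map_zero]
  | succ n ih =>
    rw [p.as_sum, map_sum, Finset.mul_sum, map_sum]
    refine Finset.sum_eq_zero fun m hm => ?_
    have hdeg : m.degree = n + 1 := by
      by_contra hne
      exact MvPolynomial.mem_support_iff.1 hm (hp.coeff_eq_zero hne)
    obtain ⟨j, hj⟩ : ∃ j, m j ≠ 0 := by
      by_contra! h0
      have : m = 0 := Finsupp.ext h0
      simp [this] at hdeg
    have hm' : Finsupp.single j 1 + (m - Finsupp.single j 1) = m :=
      add_tsub_cancel_of_le (Finsupp.single_le_iff.2 (Nat.one_le_iff_ne_zero.2 hj))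
    generalize m - Finsupp.single j 1 = m' at hm'
    generalize MvPolynomial.coeff m p = a
    subst hm'
    rw [map_add, Finsupp.degree_single] at hdeg
    have hhom : (MvPolynomial.monomial m' a).IsHomogeneous n :=
      MvPolynomial.isHomogeneous_monomial a (by omega)
    have hX : MvPolynomial.monomial (Finsupp.single j 1 + m') a =
        MvPolynomial.X j * MvPolynomial.monomial m' a := by
      rw [MvPolynomial.X, MvPolynomial.monomial_mul, one_mul]
    rw [hX, heatTrunc_succ_X_mul, heatTrunc_eq_of_le (DegLT.of_isHomogeneous hhom) _
      (Nat.le_succ _), mul_add, map_add, mul_left_comm, gaussFunctional_X_mul, Derivation.leibniz,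
      mul_smul_comm, map_smul, map_add, smul_eq_mul, smul_eq_mul, smul_eq_mul,
      mul_comm _ (MvPolynomial.pderiv j q), ih hhom (hq.pderiv j)]
    push_cast
    ring

theorem conj_evalR (d : ℕ) (p : MvPolynomial (Fin d) ℂ) (x : Fin d → ℝ) :
    (starRingEnd ℂ) (evalR d p x) = evalR d (p.map (starRingEnd ℂ)) x := by
  rw [evalR, evalR, MvPolynomial.eval_map, MvPolynomial.eval, MvPolynomial.coe_eval₂Hom,
    MvPolynomial.eval₂_comp_left]
  simp [Function.comp_def]

theorem integral_conj_evalR_mul (d : ℕ) {s : ℝ} (hs : 0 < s) (p q : MvPolynomial (Fin d) ℂ) :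
    ∫ x, (starRingEnd ℂ) (evalR d p x) * evalR d q x ∂gaussMeasure d s =
      gaussFunctional d hs (p.map (starRingEnd ℂ) * q) := by
  simp_rw [gaussFunctional_apply, conj_evalR]
  simp [evalR]

theorem continuous_evalR (d : ℕ) (p : MvPolynomial (Fin d) ℂ) : Continuous (evalR d p) :=
  (MvPolynomial.continuous_eval p).comp (by fun_prop)

theorem eq_zero_of_evalR_eq_zero (d : ℕ) {p : MvPolynomial (Fin d) ℂ}
    (h : ∀ x, evalR d p x = 0) : p = 0 := by
  refine MvPolynomial.funext_set (fun _ => Set.range ((↑) : ℝ → ℂ))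
    (fun _ => Set.infinite_range_of_injective Complex.ofReal_injective) fun z hz => ?_
  choose x hx using fun i => hz i (Set.mem_univ i)
  obtain rfl : (fun i => (x i : ℂ)) = z := funext hx
  simpa [evalR] using h x

theorem eq_zero_of_integral_conj_evalR_mul_self (d : ℕ) {s : ℝ} (hs : 0 < s)
    {p : MvPolynomial (Fin d) ℂ}
    (h : ∫ x, (starRingEnd ℂ) (evalR d p x) * evalR d p x ∂gaussMeasure d s = 0) : p = 0 := by
  have hint : Integrable (fun x => Complex.normSq (evalR d p x)) (gaussMeasure d s) := by
    refine (integrable_evalR d hs (p.map (starRingEnd ℂ) * p)).re.congr (ae_of_all _ fun x => ?_)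
    have : evalR d (p.map (starRingEnd ℂ) * p) x = (Complex.normSq (evalR d p x) : ℂ) := by
      rw [Complex.normSq_eq_conj_mul_self, conj_evalR]
      simp [evalR]
    simp [this]
  simp_rw [← Complex.normSq_eq_conj_mul_self] at h
  rw [integral_complex_ofReal, Complex.ofReal_eq_zero,
    integral_eq_zero_iff_of_nonneg (fun x => Complex.normSq_nonneg _) hint] at h
  have hae : ∀ᵐ x, evalR d p x = 0 := by
    filter_upwards [(ae_withDensity_iff (measurable_gaussDensity d s)).1 h] with x hx
    simpa using hx (ENNReal.ofReal_pos.2 (gaussDensity_pos d hs x)).ne'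
  exact eq_zero_of_evalR_eq_zero d
    (congrFun (((continuous_evalR d p).ae_eq_iff_eq volume continuous_const).1 hae))

theorem DegLT.map_conj {d n : ℕ} {p : MvPolynomial (Fin d) ℂ} (h : DegLT n p) :
    DegLT n (p.map (starRingEnd ℂ)) := fun m hm => by
  rw [MvPolynomial.coeff_map, h m hm, map_zero]

/-- Proposition 3.5, item 2. A polynomial `q` lies in the `n`-th Hermite
subspace `F_{n,s} = e^{-sΔ/2}(homogeneous polynomials of degree n)` if and only if `q` has
degree at most `n` and is orthogonal in `L²(ℝ^d, P_s)` to every polynomial of degree at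
most `n - 1` (i.e. of degree `< n`). -/
theorem hermite_subspace_characterization
    (d : ℕ) (hd : 1 ≤ d) (s : ℝ) (hs : 0 < s) (n : ℕ) (q : MvPolynomial (Fin d) ℂ) :
    (∃ p : MvPolynomial (Fin d) ℂ, p.IsHomogeneous n ∧ q = heatOp d (-s) p) ↔
    (q.totalDegree ≤ n ∧ ∀ p' : MvPolynomial (Fin d) ℂ, p'.totalDegree < n →
        ∫ x : Fin d → ℝ,
            (starRingEnd ℂ) (evalR d p' x) * evalR d q x ∂(gaussMeasure d s) = 0) := by
  constructor
  · rintro ⟨p, hp, rfl⟩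
    rw [heatOp_eq_heatTrunc (DegLT.of_isHomogeneous hp)]
    refine ⟨((DegLT.of_isHomogeneous hp).heatTrunc _ _).totalDegree_le, fun p' hp' => ?_⟩
    rw [integral_conj_evalR_mul d hs]
    exact gaussFunctional_mul_heatTrunc d hs hp (DegLT.of_totalDegree_lt hp').map_conj
  · rintro ⟨hq, horth⟩
    set p := MvPolynomial.homogeneousComponent n q with hpdef
    have hp : p.IsHomogeneous n := MvPolynomial.homogeneousComponent_isHomogeneous n q
    refine ⟨p, hp, ?_⟩
    rw [heatOp_eq_heatTrunc (DegLT.of_isHomogeneous hp), ← sub_eq_zero]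
    set r := q - heatTrunc d (-s) (n + 1) p with hr
    have hqp : DegLT n (q - p) := fun m hm => by
      rw [MvPolynomial.coeff_sub, hpdef, MvPolynomial.coeff_homogeneousComponent]
      split_ifs with h
      · exact sub_self _
      · rw [sub_zero]
        exact DegLT.of_totalDegree_lt (Nat.lt_succ_of_le hq) m (by omega)
    have hrdeg : DegLT n r := by
      have h := (DegLT.of_isHomogeneous hp).sub_heatTrunc (-s) n
      intro m hm
      have h1 := hqp m hm
      have h2 := h m hm
      rw [MvPolynomial.coeff_sub] at h1 h2
      rw [hr, MvPolynomial.coeff_sub, sub_eq_zero.1 h1, h2]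
    rcases n with _ | n
    · exact hrdeg.eq_zero
    refine eq_zero_of_integral_conj_evalR_mul_self d hs ?_
    have h1 := horth r (Nat.lt_succ_of_le hrdeg.totalDegree_le)
    rw [integral_conj_evalR_mul d hs] at h1 ⊢
    rw [hr, mul_sub, ← hr, map_sub, h1, gaussFunctional_mul_heatTrunc d hs hp hrdeg.map_conj,
      sub_zero]
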